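/- arXiv:1003.0096 — 5 statements merged into one kernel-verified Lean document; each statement's English description precedes it below -/
import Mathlib

section
/- For groups A and G, the kernel of the canonical homomorphism b : A ∗ G →* A × G equals the subgroup of A ∗ G generated by the set of commutators { ⁅inr g, inl a⁆ : g ∈ G, a ∈ A }. -/
open Monoid Coprod
open scoped commutatorElement

/-- The kernel of the canonical homomorphism `A ∗ G →* A × G` is the subgroup
generated by the commutators `⁅inr g, inl a⁆`. -/
theorem ker_toProd_eq_closure_commutators (A G : Type*) [Group A] [Group G] :
    MonoidHom.ker (Coprod.toProd : A ∗ G →* A × G) =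
      Subgroup.closure { x : A ∗ G | ∃ (g : G) (a : A),
        x = ⁅(Coprod.inr g : A ∗ G), Coprod.inl a⁆ } := by
  set K : Subgroup (A ∗ G) := Subgroup.closure { x : A ∗ G | ∃ (g : G) (a : A),
        x = ⁅(Coprod.inr g : A ∗ G), Coprod.inl a⁆ } with hK
  have hc : ∀ (g : G) (a : A), ⁅(Coprod.inr g : A ∗ G), Coprod.inl a⁆ ∈ K :=
    fun g a => Subgroup.subset_closure ⟨g, a, rfl⟩
  have conj : ∀ t : A ∗ G,
      (∀ (g : G) (a : A), t * ⁅(Coprod.inr g : A ∗ G), Coprod.inl a⁆ * t⁻¹ ∈ K) →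
      ∀ x ∈ K, t * x * t⁻¹ ∈ K := by
    intro t ht
    have h : K ≤ K.comap (MulAut.conj t).toMonoidHom := by
      rw [hK, Subgroup.closure_le]
      rintro _ ⟨g, a, rfl⟩
      exact ht g a
    intro x hx
    exact h hx
  have hl : ∀ (b : A), ∀ x ∈ K, (Coprod.inl b : A ∗ G) * x * (Coprod.inl b)⁻¹ ∈ K := by
    intro b
    refine conj _ fun g a => ?_
    have := K.mul_mem (K.inv_mem (hc g b)) (hc g (b * a))
    convert this using 1
    simp only [commutatorElement_def, map_mul]
    group
  have hr : ∀ (h : G), ∀ x ∈ K, (Coprod.inr h : A ∗ G) * x * (Coprod.inr h)⁻¹ ∈ K := by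
    intro h
    refine conj _ fun g a => ?_
    have := K.mul_mem (hc (h * g) a) (K.inv_mem (hc h a))
    convert this using 1
    simp only [commutatorElement_def, map_mul]
    group
  have key : ∀ x : A ∗ G, x * (Coprod.inl (Coprod.fst x) * Coprod.inr (Coprod.snd x))⁻¹ ∈ K := by
    intro x
    induction x using Coprod.induction_on' with
    | one => simp
    | inl_mul m x ih =>
      convert hl m _ ih using 1
      simp [mul_assoc]
    | inr_mul n x ih =>
      convert K.mul_mem (hr n _ ih) (hc n (Coprod.fst x)) using 1
      simp [mul_assoc, commutatorElement_def]
  apply le_antisymm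
  · intro x hx
    rw [MonoidHom.mem_ker, ← Coprod.prod_mk_fst_snd, Prod.mk_eq_one] at hx
    simpa [hx.1, hx.2] using key x
  · rw [hK, Subgroup.closure_le]
    rintro _ ⟨g, a, rfl⟩
    simp [MonoidHom.mem_ker, commutatorElement_def]
end

section
/- For groups A and G, let S = { (g, a) ∈ G × A : g ≠ 1 and a ≠ 1 }. The group homomorphism from the free group on S to A ∗ G sending the generator (g, a) to the commutator ⁅inr g, inl a⁆ is injective, and its range equals the kernel of the canonical homomorphism b : A ∗ G →* A × G. In other words, the kernel of b is a free group with basis the commutators ⁅inr g, inl a⁆ for g ≠ 1, a ≠ 1. -/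
open Monoid Coprod
open scoped commutatorElement

/-- The homomorphism from the free group on `S = {(g,a) : g ≠ 1, a ≠ 1}` to `A ∗ G`
sending the generator `(g,a)` to the commutator `⁅inr g, inl a⁆`. -/
noncomputable def commutatorLift (A G : Type*) [Group A] [Group G] :
    FreeGroup {p : G × A // p.1 ≠ 1 ∧ p.2 ≠ 1} →* A ∗ G :=
  FreeGroup.lift (fun p => ⁅(Coprod.inr p.val.1 : A ∗ G), Coprod.inl p.val.2⁆)

open Classical in
/-- The free generator attached to `(g, a)`, or `1` when `g = 1` or `a = 1`. -/
noncomputable def cGen {A G : Type*} [Group A] [Group G] (g : G) (a : A) :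
    FreeGroup {p : G × A // p.1 ≠ 1 ∧ p.2 ≠ 1} :=
  if h : g ≠ 1 ∧ a ≠ 1 then FreeGroup.of ⟨(g, a), h⟩ else 1

theorem cGen_one_left {A G : Type*} [Group A] [Group G] (a : A) :
    cGen (1 : G) a = 1 := by simp [cGen]

theorem cGen_one_right {A G : Type*} [Group A] [Group G] (g : G) :
    cGen g (1 : A) = 1 := by simp [cGen]

theorem cGen_val {A G : Type*} [Group A] [Group G] (p : {p : G × A // p.1 ≠ 1 ∧ p.2 ≠ 1}) :
    cGen p.val.1 p.val.2 = FreeGroup.of p := by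
  unfold cGen
  rw [dif_pos p.2]

theorem commutatorLift_cGen {A G : Type*} [Group A] [Group G] (g : G) (a : A) :
    commutatorLift A G (cGen g a) = ⁅(Coprod.inr g : A ∗ G), Coprod.inl a⁆ := by
  unfold cGen
  split_ifs with h
  · simp [commutatorLift]
  · rw [not_and_or, not_not, not_not] at h
    rcases h with rfl | rfl <;> simp

/-- The set of normal forms `f * a * g`. -/
abbrev NF (A G : Type*) [Group A] [Group G] :=
  FreeGroup {p : G × A // p.1 ≠ 1 ∧ p.2 ≠ 1} × A × G

/-- Right multiplication by `a⁻¹` on normal forms. -/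
noncomputable def actL (A G : Type*) [Group A] [Group G] : A →* Equiv.Perm (NF A G) :=
  MonoidHom.toHomPerm
    { toFun := fun b t => (t.1 * (cGen t.2.2 t.2.1)⁻¹ * cGen t.2.2 (t.2.1 * b⁻¹),
        t.2.1 * b⁻¹, t.2.2)
      map_one' := by
        funext t
        refine Eq.trans ?_ (rfl : t = _)
        simp
      map_mul' := by
        intro b c
        funext t
        refine Eq.trans ?_ (Function.comp_apply (x := t)).symm
        simp [mul_assoc] }

/-- Right multiplication by `g⁻¹` on normal forms. -/
noncomputable def actR (A G : Type*) [Group A] [Group G] : G →* Equiv.Perm (NF A G) :=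
  MonoidHom.toHomPerm
    { toFun := fun h t => (t.1, t.2.1, t.2.2 * h⁻¹)
      map_one' := by
        funext t
        refine Eq.trans ?_ (rfl : t = _)
        simp
      map_mul' := by
        intro b c
        funext t
        refine Eq.trans ?_ (Function.comp_apply (x := t)).symm
        simp [mul_assoc] }

theorem actL_apply {A G : Type*} [Group A] [Group G] (b : A) (t : NF A G) :
    actL A G b t = (t.1 * (cGen t.2.2 t.2.1)⁻¹ * cGen t.2.2 (t.2.1 * b⁻¹),
        t.2.1 * b⁻¹, t.2.2) := rfl

theorem actR_apply {A G : Type*} [Group A] [Group G] (h : G) (t : NF A G) :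
    actR A G h t = (t.1, t.2.1, t.2.2 * h⁻¹) := rfl

/-- The action of `A ∗ G` on normal forms. -/
noncomputable def act (A G : Type*) [Group A] [Group G] : A ∗ G →* Equiv.Perm (NF A G) :=
  Coprod.lift (actL A G) (actR A G)

theorem act_comm {A G : Type*} [Group A] [Group G] (g : G) (a : A)
    (f : FreeGroup {p : G × A // p.1 ≠ 1 ∧ p.2 ≠ 1}) :
    act A G ⁅(Coprod.inr g : A ∗ G), Coprod.inl a⁆ (f, 1, 1) = (f * (cGen g a)⁻¹, 1, 1) := by
  rw [commutatorElement_def, ← map_inv, ← map_inv]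
  simp [act, actL_apply, actR_apply, cGen_one_left, cGen_one_right, -map_inv]

theorem act_commutatorLift {A G : Type*} [Group A] [Group G]
    (w f : FreeGroup {p : G × A // p.1 ≠ 1 ∧ p.2 ≠ 1}) :
    act A G (commutatorLift A G w) (f, 1, 1) = (f * w⁻¹, 1, 1) := by
  induction w using FreeGroup.induction_on generalizing f with
  | C1 => simp
  | of p => rw [← cGen_val, commutatorLift_cGen, act_comm]
  | inv_of p ih =>
    rw [map_inv, map_inv, Equiv.Perm.inv_eq_iff_eq, ih]
    simp
  | mul x y hx hy =>
    rw [map_mul, map_mul, Equiv.Perm.mul_apply, hy, hx]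
    simp [mul_assoc]

/-- Evaluation of a normal form. -/
noncomputable def evalNF {A G : Type*} [Group A] [Group G] (t : NF A G) : A ∗ G :=
  commutatorLift A G t.1 * Coprod.inl t.2.1 * Coprod.inr t.2.2

theorem evalNF_act {A G : Type*} [Group A] [Group G] (x : A ∗ G) (t : NF A G) :
    evalNF (act A G x t) = evalNF t * x⁻¹ := by
  induction x using Coprod.induction_on generalizing t with
  | inl a =>
    simp only [act, Coprod.lift_apply_inl, actL_apply, evalNF, map_mul, map_inv,
      commutatorLift_cGen, commutatorElement_def]
    group
  | inr g =>
    simp only [act, Coprod.lift_apply_inr, actR_apply, evalNF, map_mul, map_inv]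
    group
  | mul x y hx hy =>
    rw [map_mul, Equiv.Perm.mul_apply, hx, hy]
    group

theorem exists_evalNF {A G : Type*} [Group A] [Group G] (x : A ∗ G) :
    ∃ t : NF A G, evalNF t = x :=
  ⟨act A G x⁻¹ (1, 1, 1), by rw [evalNF_act]; simp [evalNF]⟩

theorem toProd_commutatorLift {A G : Type*} [Group A] [Group G]
    (w : FreeGroup {p : G × A // p.1 ≠ 1 ∧ p.2 ≠ 1}) :
    (Coprod.toProd : A ∗ G →* A × G) (commutatorLift A G w) = 1 := by
  have : (Coprod.toProd : A ∗ G →* A × G).comp (commutatorLift A G) = 1 := by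
    ext p <;> simp [commutatorLift, commutatorElement_def]
  exact DFunLike.congr_fun this w

/-- The kernel of the canonical homomorphism `A ∗ G →* A × G` is free with basis the
commutators `⁅inr g, inl a⁆` with `g ≠ 1`, `a ≠ 1`: the homomorphism from the free
group on `S = {(g,a) | g ≠ 1, a ≠ 1}` sending `(g,a)` to `⁅inr g, inl a⁆` is
injective and its range is `ker toProd`. -/
theorem ker_toProd_free (A G : Type*) [Group A] [Group G] :
    Function.Injective (commutatorLift A G) ∧
    MonoidHom.range (commutatorLift A G) =
      MonoidHom.ker (Coprod.toProd : A ∗ G →* A × G) := by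
  constructor
  · intro v w h
    have hv := act_commutatorLift v 1
    rw [h, act_commutatorLift] at hv
    simpa using (congrArg Prod.fst hv).symm
  · ext x
    constructor
    · rintro ⟨w, rfl⟩
      exact toProd_commutatorLift w
    · intro hx
      obtain ⟨⟨f, a, g⟩, rfl⟩ := exists_evalNF x
      rw [MonoidHom.mem_ker] at hx
      simp only [evalNF, map_mul, toProd_commutatorLift, Coprod.toProd_apply_inl,
        Coprod.toProd_apply_inr, one_mul, Prod.mk_mul_mk, mul_one, Prod.mk_eq_one] at hx
      obtain ⟨rfl, rfl⟩ := hx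
      exact ⟨f, by simp [evalNF]⟩
end

section
/- Let A and G be groups and φ : G →* MulAut A an action of G on A. Let Φ : A ∗ G →* A ⋊[φ] G be the canonical homomorphism determined by Φ(inl a) = (a, 1) and Φ(inr g) = (1, g) (i.e. Φ ∘ inl and Φ ∘ inr are the canonical inclusions of the semidirect product). Then Φ is surjective and its kernel equals the normal closure in A ∗ G of the set { ⁅inr g, inl a⁆ * (inl (φ g a * a⁻¹))⁻¹ : g ∈ G, a ∈ A }. Equivalently, the canonical epimorphism A ∗ G → A ⋊[φ] G is the coequalizer of the inclusion ι : (A|G) → A ∗ G and inl ∘ ψ, where (A|G) = ker b and ψ is the homomorphism on (A|G) with ψ(⁅inr g, inl a⁆) = φ g a * a⁻¹. -/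
open Monoid Coprod
open scoped commutatorElement

/-- For an action `φ : G →* MulAut A`, the canonical homomorphism
`Φ : A ∗ G →* A ⋊[φ] G` (with `Φ ∘ inl`, `Φ ∘ inr` the canonical inclusions)
is surjective, and its kernel is the normal closure of the set of elements
`⁅inr g, inl a⁆ * (inl (φ g a * a⁻¹))⁻¹`.  Equivalently, `A ∗ G → A ⋊[φ] G` is the
coequalizer of the inclusion `(A|G) → A ∗ G` and `inl ∘ ψ` where
`ψ(⁅inr g, inl a⁆) = φ g a * a⁻¹`. -/
theorem semidirectProduct_presentation (A G : Type*) [Group A] [Group G]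
    (φ : G →* MulAut A) :
    Function.Surjective
      (Coprod.lift SemidirectProduct.inl SemidirectProduct.inr :
        A ∗ G →* A ⋊[φ] G) ∧
    MonoidHom.ker
      (Coprod.lift SemidirectProduct.inl SemidirectProduct.inr :
        A ∗ G →* A ⋊[φ] G) =
    Subgroup.normalClosure
      { y : A ∗ G | ∃ (g : G) (a : A),
          y = ⁅(Coprod.inr g : A ∗ G), Coprod.inl a⁆ *
            (Coprod.inl (φ g a * a⁻¹))⁻¹ } := by
  refine ⟨fun x => ⟨Coprod.inl x.left * Coprod.inr x.right, by simp⟩, le_antisymm ?_ ?_⟩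
  · set S : Set (A ∗ G) := { y : A ∗ G | ∃ (g : G) (a : A),
          y = ⁅(Coprod.inr g : A ∗ G), Coprod.inl a⁆ *
            (Coprod.inl (φ g a * a⁻¹))⁻¹ } with hS
    let q := QuotientGroup.mk' (Subgroup.normalClosure S)
    have key : ∀ (g : G) (a : A),
        q (Coprod.inl (φ g a)) = q (Coprod.inr g) * q (Coprod.inl a) * (q (Coprod.inr g))⁻¹ := by
      intro g a
      have h : q (⁅(Coprod.inr g : A ∗ G), Coprod.inl a⁆ *
            (Coprod.inl (φ g a * a⁻¹))⁻¹) = 1 :=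
        (QuotientGroup.eq_one_iff _).2 (Subgroup.subset_normalClosure ⟨g, a, rfl⟩)
      rw [map_mul, map_inv, mul_inv_eq_one] at h
      simp only [commutatorElement_def, map_mul, map_inv] at h
      exact (mul_right_cancel h).symm
    let L : A ⋊[φ] G →* (A ∗ G) ⧸ Subgroup.normalClosure S :=
      SemidirectProduct.lift (q.comp Coprod.inl) (q.comp Coprod.inr) (by
        intro g
        ext a
        exact key g a)
    have hL : L.comp (Coprod.lift SemidirectProduct.inl SemidirectProduct.inr) = q := by
      apply Coprod.hom_ext
      · ext a
        simp [L]
      · ext g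
        simp [L]
    intro x hx
    rw [MonoidHom.mem_ker] at hx
    have h1 : q x = 1 := by
      rw [← hL, MonoidHom.comp_apply, hx, map_one]
    exact (QuotientGroup.eq_one_iff x).1 h1
  · apply Subgroup.normalClosure_le_normal
    rintro _ ⟨g, a, rfl⟩
    rw [SetLike.mem_coe, MonoidHom.mem_ker]
    simp [commutatorElement_def, SemidirectProduct.inl_aut]
end

section
/- Let A and G be groups, let K be the kernel of the canonical homomorphism b : A ∗ G →* A × G (so K is normal in A ∗ G), and let ψ : K →* A be a group homomorphism. Define φ : G → A → A by φ g a := ψ(⁅inr g, inl a⁆) * a (the commutator ⁅inr g, inl a⁆ lies in K). Then the following are equivalent: (i) for all a ∈ A and all x ∈ K, ψ(inl a * x * (inl a)⁻¹) = a * ψ(x) * a⁻¹ (where inl a * x * (inl a)⁻¹ ∈ K by normality of K); (ii) for every g ∈ G the map φ g : A → A is multiplicative, i.e. φ g (a * a') = (φ g a) * (φ g a') for all a, a' ∈ A. -/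
open Monoid Coprod
open scoped commutatorElement

/-- The subgroup generated by the basic commutators. -/
def commSub (A G : Type*) [Group A] [Group G] : Subgroup (A ∗ G) :=
  Subgroup.closure {x | ∃ (g : G) (a : A), x = ⁅(Coprod.inr g : A ∗ G), Coprod.inl a⁆}

lemma comm_mem_commSub {A G : Type*} [Group A] [Group G] (g : G) (a : A) :
    ⁅(Coprod.inr g : A ∗ G), Coprod.inl a⁆ ∈ commSub A G :=
  Subgroup.subset_closure ⟨g, a, rfl⟩

lemma conj_mem_closure {H : Type*} [Group H] (S : Set H) (h : H)
    (hS : ∀ x ∈ S, h * x * h⁻¹ ∈ Subgroup.closure S) (x : H) (hx : x ∈ Subgroup.closure S) :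
    h * x * h⁻¹ ∈ Subgroup.closure S := by
  have : Subgroup.closure S ≤ (Subgroup.closure S).comap (MulAut.conj h).toMonoidHom := by
    rw [Subgroup.closure_le]
    intro y hy
    simpa using hS y hy
  simpa using this hx

lemma conj_inl_mem {A G : Type*} [Group A] [Group G] (a : A) (x : A ∗ G)
    (hx : x ∈ commSub A G) : Coprod.inl a * x * (Coprod.inl a)⁻¹ ∈ commSub A G := by
  refine conj_mem_closure _ _ ?_ x hx
  rintro _ ⟨g, a', rfl⟩
  have h : (Coprod.inl a : A ∗ G) * ⁅(Coprod.inr g : A ∗ G), Coprod.inl a'⁆ * (Coprod.inl a)⁻¹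
      = ⁅(Coprod.inr g : A ∗ G), Coprod.inl a⁆⁻¹ *
        ⁅(Coprod.inr g : A ∗ G), Coprod.inl (a * a')⁆ := by
    simp only [commutatorElement_def, map_mul]; group
  rw [h]
  exact mul_mem (inv_mem (comm_mem_commSub g a)) (comm_mem_commSub g (a * a'))

lemma conj_inr_mem {A G : Type*} [Group A] [Group G] (g : G) (x : A ∗ G)
    (hx : x ∈ commSub A G) : Coprod.inr g * x * (Coprod.inr g)⁻¹ ∈ commSub A G := by
  refine conj_mem_closure _ _ ?_ x hx
  rintro _ ⟨g', a, rfl⟩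
  have h : (Coprod.inr g : A ∗ G) * ⁅(Coprod.inr g' : A ∗ G), Coprod.inl a⁆ * (Coprod.inr g)⁻¹
      = ⁅(Coprod.inr (g * g') : A ∗ G), Coprod.inl a⁆ *
        ⁅(Coprod.inr g : A ∗ G), Coprod.inl a⁆⁻¹ := by
    simp only [commutatorElement_def, map_mul]; group
  rw [h]
  exact mul_mem (comm_mem_commSub (g * g') a) (inv_mem (comm_mem_commSub g a))

lemma exists_decomp {A G : Type*} [Group A] [Group G] (w : A ∗ G) :
    ∃ s ∈ commSub A G, ∃ (a : A) (g : G), w = s * Coprod.inl a * Coprod.inr g := by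
  induction w using Coprod.induction_on' with
  | one => exact ⟨1, one_mem _, 1, 1, by simp⟩
  | inl_mul a w ih =>
    obtain ⟨s, hs, a', g', rfl⟩ := ih
    refine ⟨_, conj_inl_mem a s hs, a * a', g', ?_⟩
    simp only [map_mul]; group
  | inr_mul g w ih =>
    obtain ⟨s, hs, a', g', rfl⟩ := ih
    refine ⟨_, mul_mem (conj_inr_mem g s hs) (comm_mem_commSub g a'), a', g * g', ?_⟩
    simp only [commutatorElement_def, map_mul]; group

lemma ker_le_commSub {A G : Type*} [Group A] [Group G] :
    MonoidHom.ker (Coprod.toProd : A ∗ G →* A × G) ≤ commSub A G := by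
  intro w hw
  obtain ⟨s, hs, a, g, rfl⟩ := exists_decomp w
  have hk : commSub A G ≤ MonoidHom.ker (Coprod.toProd : A ∗ G →* A × G) := by
    refine (Subgroup.closure_le _).2 ?_
    rintro _ ⟨g, a, rfl⟩
    simp [MonoidHom.mem_ker, commutatorElement_def]
  have h1 := MonoidHom.mem_ker.1 (hk hs)
  rw [MonoidHom.mem_ker, map_mul, map_mul, h1] at hw
  simp only [toProd_apply_inl, toProd_apply_inr, one_mul, Prod.mk_mul_mk, mul_one,
    Prod.mk_eq_one] at hw
  obtain ⟨rfl, rfl⟩ := hw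
  simpa using hs

/-- For `ψ : K →* A` with `K = ker (toProd : A ∗ G →* A × G)` and
`φ g a := ψ ⁅inr g, inl a⁆ * a`, the following are equivalent:
(i) `ψ (inl a * x * (inl a)⁻¹) = a * ψ x * a⁻¹` for all `a ∈ A`, `x ∈ K`;
(ii) each `φ g : A → A` is multiplicative. -/
theorem conj_compat_iff_multiplicative (A G : Type*) [Group A] [Group G]
    (ψ : MonoidHom.ker (Coprod.toProd : A ∗ G →* A × G) →* A)
    (hmem : ∀ (g : G) (a : A),
      ⁅(Coprod.inr g : A ∗ G), Coprod.inl a⁆ ∈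
        MonoidHom.ker (Coprod.toProd : A ∗ G →* A × G))
    (hconj : ∀ (a : A) (x : MonoidHom.ker (Coprod.toProd : A ∗ G →* A × G)),
      Coprod.inl a * (x : A ∗ G) * (Coprod.inl a)⁻¹ ∈
        MonoidHom.ker (Coprod.toProd : A ∗ G →* A × G)) :
    (∀ (a : A) (x : MonoidHom.ker (Coprod.toProd : A ∗ G →* A × G)),
      ψ ⟨Coprod.inl a * (x : A ∗ G) * (Coprod.inl a)⁻¹, hconj a x⟩ = a * ψ x * a⁻¹)
    ↔
    (∀ (g : G) (a a' : A),
      ψ ⟨⁅(Coprod.inr g : A ∗ G), Coprod.inl (a * a')⁆, hmem g (a * a')⟩ * (a * a') =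
      (ψ ⟨⁅(Coprod.inr g : A ∗ G), Coprod.inl a⁆, hmem g a⟩ * a) *
      (ψ ⟨⁅(Coprod.inr g : A ∗ G), Coprod.inl a'⁆, hmem g a'⟩ * a')) := by
  have key : ∀ (g : G) (a a' : A),
      ψ ⟨⁅(Coprod.inr g : A ∗ G), Coprod.inl (a * a')⁆, hmem g (a * a')⟩ =
      ψ ⟨⁅(Coprod.inr g : A ∗ G), Coprod.inl a⁆, hmem g a⟩ *
      ψ ⟨Coprod.inl a * ⁅(Coprod.inr g : A ∗ G), Coprod.inl a'⁆ * (Coprod.inl a)⁻¹,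
        hconj a ⟨_, hmem g a'⟩⟩ := by
    intro g a a'
    rw [← map_mul]
    congr 1
    apply Subtype.ext
    simp only [Subgroup.coe_mul, commutatorElement_def, map_mul]
    group
  constructor
  · intro h g a a'
    rw [key, h a ⟨_, hmem g a'⟩]
    group
  · intro h a x
    let c : MonoidHom.ker (Coprod.toProd : A ∗ G →* A × G) →*
        MonoidHom.ker (Coprod.toProd : A ∗ G →* A × G) :=
      { toFun := fun x => ⟨_, hconj a x⟩
        map_one' := by apply Subtype.ext; simp
        map_mul' := by
          intro x y
          apply Subtype.ext
          simp only [Subgroup.coe_mul]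
          group }
    have main : commSub A G ≤
        ((ψ.comp c).eqLocus ((MulAut.conj a).toMonoidHom.comp ψ)).map
          (Subgroup.subtype _) := by
      refine (Subgroup.closure_le _).2 ?_
      rintro _ ⟨g, a', rfl⟩
      refine ⟨⟨_, hmem g a'⟩, ?_, rfl⟩
      change ψ ⟨_, hconj a ⟨_, hmem g a'⟩⟩ = a * ψ ⟨_, hmem g a'⟩ * a⁻¹
      have h2 := h g a a'
      rw [key] at h2
      rw [eq_mul_inv_iff_mul_eq]
      simp only [← mul_assoc, mul_left_inj] at h2
      rw [mul_assoc, mul_assoc (ψ _) a] at h2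
      exact mul_left_cancel h2
    obtain ⟨y, hy, hyx⟩ := main (ker_le_commSub x.2)
    obtain rfl : y = x := Subtype.ext hyx
    exact hy
end

section
/- Let A and G be groups, K the kernel of the canonical homomorphism b : A ∗ G →* A × G, ψ : K →* A a group homomorphism, and φ : G → A → A defined by φ g a := ψ(⁅inr g, inl a⁆) * a. Assume that for every g ∈ G the map φ g : A → A is multiplicative. Then the following are equivalent: (i) for all g, g₁ ∈ G and a ∈ A, ψ(⁅inr g, ⁅inr g₁, inl a⁆⁆) = ψ(⁅inr g, inl (ψ ⁅inr g₁, inl a⁆)⁆) (both iterated commutators lie in K since K is normal in A ∗ G); (ii) for all g, g₁ ∈ G and a ∈ A, φ (g * g₁) a = φ g (φ g₁ a). -/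
open Monoid Coprod
open scoped commutatorElement

/-- For `ψ : K →* A` with `K = ker (toProd : A ∗ G →* A × G)` and
`φ g a := ψ ⁅inr g, inl a⁆ * a`, assuming each `φ g` is multiplicative, the
following are equivalent:
(i) `ψ ⁅inr g, ⁅inr g₁, inl a⁆⁆ = ψ ⁅inr g, inl (ψ ⁅inr g₁, inl a⁆)⁆` for all
`g, g₁, a`;
(ii) `φ (g * g₁) a = φ g (φ g₁ a)` for all `g, g₁, a`. -/
theorem assoc_iff_action (A G : Type*) [Group A] [Group G]
    (ψ : MonoidHom.ker (Coprod.toProd : A ∗ G →* A × G) →* A)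
    (hmem : ∀ (g : G) (a : A),
      ⁅(Coprod.inr g : A ∗ G), Coprod.inl a⁆ ∈
        MonoidHom.ker (Coprod.toProd : A ∗ G →* A × G))
    (hmem2 : ∀ (g : G) (x : A ∗ G),
      x ∈ MonoidHom.ker (Coprod.toProd : A ∗ G →* A × G) →
      ⁅(Coprod.inr g : A ∗ G), x⁆ ∈
        MonoidHom.ker (Coprod.toProd : A ∗ G →* A × G))
    (hmul : ∀ (g : G) (a a' : A),
      ψ ⟨⁅(Coprod.inr g : A ∗ G), Coprod.inl (a * a')⁆, hmem g (a * a')⟩ * (a * a') =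
      (ψ ⟨⁅(Coprod.inr g : A ∗ G), Coprod.inl a⁆, hmem g a⟩ * a) *
      (ψ ⟨⁅(Coprod.inr g : A ∗ G), Coprod.inl a'⁆, hmem g a'⟩ * a')) :
    (∀ (g g₁ : G) (a : A),
      ψ ⟨⁅(Coprod.inr g : A ∗ G), ⁅(Coprod.inr g₁ : A ∗ G), Coprod.inl a⁆⁆,
          hmem2 g _ (hmem g₁ a)⟩ =
      ψ ⟨⁅(Coprod.inr g : A ∗ G),
          Coprod.inl (ψ ⟨⁅(Coprod.inr g₁ : A ∗ G), Coprod.inl a⁆, hmem g₁ a⟩)⁆,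
          hmem g _⟩)
    ↔
    (∀ (g g₁ : G) (a : A),
      ψ ⟨⁅(Coprod.inr (g * g₁) : A ∗ G), Coprod.inl a⁆, hmem (g * g₁) a⟩ * a =
      ψ ⟨⁅(Coprod.inr g : A ∗ G),
          Coprod.inl (ψ ⟨⁅(Coprod.inr g₁ : A ∗ G), Coprod.inl a⁆, hmem g₁ a⟩ * a)⁆,
          hmem g _⟩ *
        (ψ ⟨⁅(Coprod.inr g₁ : A ∗ G), Coprod.inl a⁆, hmem g₁ a⟩ * a)) := by
  refine forall_congr' fun g => forall_congr' fun g₁ => forall_congr' fun a => ?_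
  have key : ψ ⟨⁅(Coprod.inr (g * g₁) : A ∗ G), Coprod.inl a⁆, hmem (g * g₁) a⟩ =
      ψ ⟨⁅(Coprod.inr g : A ∗ G), ⁅(Coprod.inr g₁ : A ∗ G), Coprod.inl a⁆⁆,
          hmem2 g _ (hmem g₁ a)⟩ *
      ψ ⟨⁅(Coprod.inr g₁ : A ∗ G), Coprod.inl a⁆, hmem g₁ a⟩ *
      ψ ⟨⁅(Coprod.inr g : A ∗ G), Coprod.inl a⁆, hmem g a⟩ := by
    rw [← map_mul, ← map_mul]
    congr 1
    apply Subtype.ext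
    simp only [Subgroup.coe_mul, map_mul, commutatorElement_def]
    group
  rw [hmul, key]
  simp only [mul_assoc]
  exact (mul_left_inj _).symm
end
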